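/- arXiv:0810.4595 — 6 statements merged into one kernel-verified Lean document; each statement's English description precedes it below -/
import Mathlib

section
/- Let F ∈ ℝ[x_1,…,x_n] be a Casimir invariant of 𝔰 and let Φ_0 be the bi-homogeneous component of F of complementary degree 0, i.e. the sum of all monomials of F involving only the variables x_1,…,x_s. Then Φ_0 is a Casimir invariant of the subalgebra 𝔰′ in its own variables: Σ_{j≤s, k≤s} C_{ij}^k x_k ∂Φ_0/∂x_j = 0 for every i with 1 ≤ i ≤ s. -/
/-- The differential operator `X̂ i : F ↦ Σ_{j,k} C i j k · x_k · ∂F/∂x_j`. -/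
noncomputable def hatOp {n : ℕ} (C : Fin n → Fin n → Fin n → ℝ) (i : Fin n)
    (F : MvPolynomial (Fin n) ℝ) : MvPolynomial (Fin n) ℝ :=
  ∑ j : Fin n, ∑ k : Fin n,
    MvPolynomial.C (C i j k) * MvPolynomial.X k * MvPolynomial.pderiv j F

/-- Complementary degree of a monomial exponent `d`:
its total degree in the variables `x_{s+1},…,x_n`. -/
def compDeg {n : ℕ} (s : ℕ) (d : Fin n →₀ ℕ) : ℕ :=
  ∑ j ∈ Finset.univ.filter (fun j : Fin n => s ≤ (j : ℕ)), d j

/-- The component of a polynomial `F` of complementary degree `b`: the sum of all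
monomials of `F` whose total degree in the variables `x_{s+1},…,x_n` equals `b`. -/
noncomputable def compComponent {n : ℕ} (s : ℕ) (F : MvPolynomial (Fin n) ℝ) (b : ℕ) :
    MvPolynomial (Fin n) ℝ :=
  ∑ d ∈ F.support.filter (fun d => compDeg s d = b),
    MvPolynomial.monomial d (F.coeff d)

noncomputable def killComp {n : ℕ} (s : ℕ) :
    MvPolynomial (Fin n) ℝ →ₐ[ℝ] MvPolynomial (Fin n) ℝ :=
  MvPolynomial.aeval (fun j : Fin n => if (j : ℕ) < s then MvPolynomial.X j else 0)

lemma killComp_monomial {n : ℕ} (s : ℕ) (d : Fin n →₀ ℕ) (a : ℝ) :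
    killComp s (MvPolynomial.monomial d a) =
      if compDeg s d = 0 then MvPolynomial.monomial d a else 0 := by
  unfold killComp
  rw [MvPolynomial.aeval_monomial]
  split_ifs with h
  · rw [MvPolynomial.monomial_eq, MvPolynomial.algebraMap_eq]
    congr 1
    refine Finsupp.prod_congr fun j hj => ?_
    have : (j : ℕ) < s := by
      by_contra hlt
      unfold compDeg at h
      rw [Finset.sum_eq_zero_iff] at h
      exact (Finsupp.mem_support_iff.mp hj) (h j (by simpa using hlt))
    rw [if_pos this]
  · unfold compDeg at h
    obtain ⟨j, hj, hd⟩ := Finset.exists_ne_zero_of_sum_ne_zero h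
    have hj' : ¬ (j : ℕ) < s := by simpa using hj
    rw [Finsupp.prod, Finset.prod_eq_zero (Finsupp.mem_support_iff.mpr hd), mul_zero]
    rw [if_neg hj', zero_pow hd]

lemma killComp_eq {n : ℕ} (s : ℕ) (F : MvPolynomial (Fin n) ℝ) :
    killComp s F = compComponent s F 0 := by
  conv_lhs => rw [F.as_sum]
  rw [map_sum, compComponent, Finset.sum_filter]
  exact Finset.sum_congr rfl fun d _ => killComp_monomial s d _

lemma pderiv_killComp {n : ℕ} (s : ℕ) (j : Fin n) (hj : (j : ℕ) < s)
    (F : MvPolynomial (Fin n) ℝ) :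
    MvPolynomial.pderiv j (killComp s F) = killComp s (MvPolynomial.pderiv j F) := by
  induction F using MvPolynomial.induction_on with
  | C a => simp [killComp]
  | add p q hp hq => simp [hp, hq]
  | mul_X p k hp =>
    have hX : MvPolynomial.pderiv j (killComp s (MvPolynomial.X k)) =
        killComp s (MvPolynomial.pderiv j (MvPolynomial.X k)) := by
      by_cases hjk : k = j
      · subst hjk
        simp [killComp, hj]
      · rw [MvPolynomial.pderiv_X_of_ne hjk]
        by_cases hk : (k : ℕ) < s
        · simp [killComp, hk, MvPolynomial.pderiv_X_of_ne hjk]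
        · simp [killComp, hk]
    simp only [map_mul, Derivation.leibniz, smul_eq_mul, map_add, hp, hX]

/-- if `F` is a Casimir invariant of `𝔰` and `Φ₀` is the component of `F`
of complementary degree `0` (the sum of all monomials of `F` involving only
`x_1,…,x_s`), then `Φ₀` is a Casimir invariant of the subalgebra `𝔰′` in its own
variables: `Σ_{j≤s,k≤s} C i j k · x_k · ∂Φ₀/∂x_j = 0` for every `i ≤ s`. -/
theorem compComponent_zero_is_subalgebra_casimir
    {n s : ℕ} (hs : s ≤ n) (C : Fin n → Fin n → Fin n → ℝ)
    -- antisymmetry of the structure constants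
    (hanti : ∀ i j k : Fin n, C i j k = - C j i k)
    -- Jacobi identity for the structure constants
    (hjac : ∀ i j l r : Fin n,
      ∑ m : Fin n, (C i j m * C m l r + C j l m * C m i r + C l i m * C m j r) = 0)
    -- `X_1,…,X_s` span a subalgebra `𝔰′`
    (hsub : ∀ i j k : Fin n, (i : ℕ) < s → (j : ℕ) < s → s ≤ (k : ℕ) → C i j k = 0)
    -- the complementary subspace `m` satisfies `[𝔰′, m] ⊆ m`
    (hmod : ∀ i j k : Fin n, (i : ℕ) < s → s ≤ (j : ℕ) → (k : ℕ) < s → C i j k = 0)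
    (F : MvPolynomial (Fin n) ℝ)
    (hF : ∀ i : Fin n, hatOp C i F = 0) :
    ∀ i : Fin n, (i : ℕ) < s →
      (∑ j : Fin n, ∑ k : Fin n,
        if (j : ℕ) < s ∧ (k : ℕ) < s then
          MvPolynomial.C (C i j k) * MvPolynomial.X k *
            MvPolynomial.pderiv j (compComponent s F 0)
        else 0) = 0 := by
  intro i hi
  have h := congrArg (killComp s) (hF i)
  rw [hatOp, map_zero] at h
  simp only [map_sum, map_mul] at h
  refine Eq.trans ?_ h
  refine Finset.sum_congr rfl fun j _ => Finset.sum_congr rfl fun k _ => ?_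
  have hC : killComp s (MvPolynomial.C (C i j k) : MvPolynomial (Fin n) ℝ) = MvPolynomial.C (C i j k) := by
    simp [killComp]
  have hX : killComp s (MvPolynomial.X k : MvPolynomial (Fin n) ℝ) =
      if (k : ℕ) < s then MvPolynomial.X k else 0 := by
    simp [killComp]
  rw [hC, hX]
  by_cases hk : (k : ℕ) < s
  · by_cases hj : (j : ℕ) < s
    · rw [if_pos ⟨hj, hk⟩, if_pos hk, ← killComp_eq, pderiv_killComp s j hj]
    · rw [hmod i j k hi (not_lt.mp hj) hk]
      simp
  · simp [hk]
end

section
/- Let F ∈ ℝ[x_1,…,x_n] be a Casimir invariant of 𝔰, let M be the maximal complementary degree occurring among the bi-homogeneous components of F, and let F′ be the sum of the components of F of complementary degree M. Then F′ is a Casimir invariant of the Inönü–Wigner contraction of 𝔰 along 𝔰′; explicitly, X̂_i(F′) = 0 for all 1 ≤ i ≤ s, and Σ_{j≤s} (Σ_{k>s} C_{ij}^k x_k) ∂F′/∂x_j = 0 for all i with s < i ≤ n. -/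
theorem coeff_compComponent {n : ℕ} (s : ℕ) (F : MvPolynomial (Fin n) ℝ) (b : ℕ)
    (d : Fin n →₀ ℕ) :
    (compComponent s F b).coeff d = if compDeg s d = b then F.coeff d else 0 := by
  classical
  unfold compComponent
  rw [MvPolynomial.coeff_sum]
  simp only [MvPolynomial.coeff_monomial, Finset.sum_ite_eq', Finset.mem_filter,
    MvPolynomial.mem_support_iff]
  by_cases h : F.coeff d = 0 <;> simp [h]

theorem compComponent_add {n : ℕ} (s : ℕ) (F G : MvPolynomial (Fin n) ℝ) (b : ℕ) :
    compComponent s (F + G) b = compComponent s F b + compComponent s G b := by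
  ext d
  simp only [MvPolynomial.coeff_add, coeff_compComponent]
  split_ifs <;> simp

theorem compComponent_zero {n : ℕ} (s : ℕ) (b : ℕ) :
    compComponent s (0 : MvPolynomial (Fin n) ℝ) b = 0 := by
  ext d
  simp [coeff_compComponent]

theorem compComponent_sum {n : ℕ} {ι : Type*} (s : ℕ) (t : Finset ι)
    (f : ι → MvPolynomial (Fin n) ℝ) (b : ℕ) :
    compComponent s (∑ i ∈ t, f i) b = ∑ i ∈ t, compComponent s (f i) b := by
  classical
  induction t using Finset.induction_on with
  | empty => simp [compComponent_zero]
  | insert a t ha ih => rw [Finset.sum_insert ha, Finset.sum_insert ha, compComponent_add, ih]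

theorem compComponent_monomial {n : ℕ} (s : ℕ) (d : Fin n →₀ ℕ) (r : ℝ) (b : ℕ) :
    compComponent s (MvPolynomial.monomial d r) b =
      if compDeg s d = b then MvPolynomial.monomial d r else 0 := by
  classical
  ext e
  rw [coeff_compComponent]
  by_cases h : d = e
  · subst h; split_ifs <;> simp
  · split_ifs <;> simp [MvPolynomial.coeff_monomial, h]

theorem compDeg_add {n : ℕ} (s : ℕ) (d e : Fin n →₀ ℕ) :
    compDeg s (d + e) = compDeg s d + compDeg s e := by
  simp [compDeg, Finset.sum_add_distrib]

theorem compDeg_single {n : ℕ} (s : ℕ) (j : Fin n) :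
    compDeg s (Finsupp.single j 1) = if s ≤ (j : ℕ) then 1 else 0 := by
  classical
  simp [compDeg, Finsupp.single_apply]

theorem compComponent_term {n : ℕ} (s : ℕ) (c : ℝ) (j k : Fin n) (a b : ℕ)
    (hab : a + (if s ≤ (k : ℕ) then 1 else 0) = b + (if s ≤ (j : ℕ) then 1 else 0))
    (F : MvPolynomial (Fin n) ℝ) :
    compComponent s (MvPolynomial.C c * MvPolynomial.X k * MvPolynomial.pderiv j F) b =
      MvPolynomial.C c * MvPolynomial.X k * MvPolynomial.pderiv j (compComponent s F a) := by
  classical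
  induction F using MvPolynomial.induction_on' with
  | add p q hp hq => simp only [map_add, mul_add, compComponent_add, hp, hq]
  | monomial d r =>
    have key : MvPolynomial.C c * MvPolynomial.X k *
        MvPolynomial.pderiv j (MvPolynomial.monomial d r) =
        MvPolynomial.monomial (Finsupp.single k 1 + (d - Finsupp.single j 1))
          (c * (r * d j)) := by
      rw [MvPolynomial.pderiv_monomial, MvPolynomial.X, MvPolynomial.C_mul_monomial,
        MvPolynomial.monomial_mul, mul_one]
    rw [key, compComponent_monomial, compComponent_monomial]
    by_cases hd : d j = 0
    · have : MvPolynomial.pderiv j (MvPolynomial.monomial d r) = 0 := by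
        rw [MvPolynomial.pderiv_monomial]; simp [hd]
      split_ifs <;> simp [hd]
    · have hle : Finsupp.single j 1 ≤ d := by
        rw [Finsupp.single_le_iff]; omega
      have h1 : compDeg s d = compDeg s (d - Finsupp.single j 1) +
          (if s ≤ (j : ℕ) then 1 else 0) := by
        rw [← compDeg_single, ← compDeg_add, tsub_add_cancel_of_le hle]
      have h2 : (compDeg s (Finsupp.single k 1 + (d - Finsupp.single j 1)) = b) ↔
          compDeg s d = a := by
        rw [compDeg_add, compDeg_single, h1]; omega
      rw [if_congr h2 rfl rfl]
      split_ifs with h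
      · exact key.symm
      · simp

theorem compComponent_of_lt {n : ℕ} (s : ℕ) (F : MvPolynomial (Fin n) ℝ) (a : ℕ)
    (h : F.support.sup (compDeg s) < a) : compComponent s F a = 0 := by
  ext d
  rw [coeff_compComponent]
  split_ifs with hd
  · by_contra hne
    have := Finset.le_sup (f := compDeg s) (MvPolynomial.mem_support_iff.2 (fun h0 => hne (by simp [h0])) : d ∈ F.support)
    omega
  · simp

/-- let `F` be a Casimir invariant of `𝔰`, let `M` be the maximal
complementary degree occurring in `F`, and let `F′` be the sum of the components of `F`
of complementary degree `M`.  Then `F′` is a Casimir invariant of the Inönü–Wigner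
contraction of `𝔰` along `𝔰′`: `X̂ i F′ = 0` for all `i ≤ s`, and
`Σ_{j≤s} (Σ_{k>s} C i j k · x_k) ∂F′/∂x_j = 0` for all `i > s`. -/
theorem top_compComponent_is_contraction_casimir
    {n s : ℕ} (hs : s ≤ n) (C : Fin n → Fin n → Fin n → ℝ)
    -- antisymmetry of the structure constants
    (hanti : ∀ i j k : Fin n, C i j k = - C j i k)
    -- Jacobi identity for the structure constants
    (hjac : ∀ i j l r : Fin n,
      ∑ m : Fin n, (C i j m * C m l r + C j l m * C m i r + C l i m * C m j r) = 0)
    -- `X_1,…,X_s` span a subalgebra `𝔰′`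
    (hsub : ∀ i j k : Fin n, (i : ℕ) < s → (j : ℕ) < s → s ≤ (k : ℕ) → C i j k = 0)
    -- the complementary subspace `m` satisfies `[𝔰′, m] ⊆ m`
    (hmod : ∀ i j k : Fin n, (i : ℕ) < s → s ≤ (j : ℕ) → (k : ℕ) < s → C i j k = 0)
    (F : MvPolynomial (Fin n) ℝ)
    (hF : ∀ i : Fin n, hatOp C i F = 0) :
    (∀ i : Fin n, (i : ℕ) < s →
        hatOp C i (compComponent s F (F.support.sup (compDeg s))) = 0) ∧
    (∀ i : Fin n, s ≤ (i : ℕ) →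
        (∑ j : Fin n,
          if (j : ℕ) < s then
            (∑ k : Fin n, if s ≤ (k : ℕ) then MvPolynomial.C (C i j k) * MvPolynomial.X k
              else 0) *
              MvPolynomial.pderiv j (compComponent s F (F.support.sup (compDeg s)))
          else 0) = 0) := by
  refine ⟨fun i hi => ?_, fun i hi => ?_⟩
  · have h := congrArg (fun G => compComponent s G (F.support.sup (compDeg s))) (hF i)
    simp only [hatOp, compComponent_sum, compComponent_zero] at h
    rw [hatOp]
    refine Eq.trans ?_ h
    refine Finset.sum_congr rfl fun j _ => Finset.sum_congr rfl fun k _ => ?_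
    by_cases hj : s ≤ (j : ℕ) <;> by_cases hk : s ≤ (k : ℕ)
    · rw [compComponent_term s _ j k (F.support.sup (compDeg s)) _ (by simp [hj, hk])]
    · simp [hmod i j k hi hj (by omega), compComponent_zero]
    · simp [hsub i j k hi (by omega) hk, compComponent_zero]
    · rw [compComponent_term s _ j k (F.support.sup (compDeg s)) _ (by simp [hj, hk])]
  · have h := congrArg (fun G => compComponent s G (F.support.sup (compDeg s) + 1)) (hF i)
    simp only [hatOp, compComponent_sum, compComponent_zero] at h
    refine Eq.trans ?_ h
    refine Finset.sum_congr rfl fun j _ => ?_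
    by_cases hj : (j : ℕ) < s
    · rw [if_pos hj, Finset.sum_mul]
      refine Finset.sum_congr rfl fun k _ => ?_
      by_cases hk : s ≤ (k : ℕ)
      · rw [if_pos hk, compComponent_term s _ j k (F.support.sup (compDeg s)) _
          (by simp [hk, hj])]
      · rw [if_neg hk, hanti i j k, hmod j i k hj hi (by omega)]
        simp [compComponent_zero]
    · rw [if_neg hj]
      refine (Finset.sum_eq_zero fun k _ => ?_).symm
      rw [compComponent_term s _ j k
        (F.support.sup (compDeg s) + 2 - (if s ≤ (k : ℕ) then 1 else 0)) _
          (by split_ifs <;> omega),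
        compComponent_of_lt s F _ (by split_ifs <;> omega)]
      simp
end

section
/- Let A be the n×n matrix with entries A_{ij} = Σ_k C_{ij}^k x_k over the polynomial ring ℝ[x_1,…,x_n], and let B be the n×n matrix with entries B_{ij} = Σ_k C′_{ij}^k x_k, where the contracted structure constants are C′_{ij}^k = C_{ij}^k whenever (i,j,k ≤ s) or (i ≤ s < j and k > s) or (j ≤ s < i and k > s), and C′_{ij}^k = 0 otherwise. Then the rank of B over the fraction field ℝ(x_1,…,x_n) is at most the rank of A over ℝ(x_1,…,x_n); consequently the number of functionally independent invariants N(𝔤) = n − rank B of the contraction 𝔤 is at least the number N(𝔰) = n − rank A for 𝔰. -/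
lemma exists_minor_aux {K : Type*} [Field K] {n k : ℕ} (B : Matrix (Fin n) (Fin n) K)
    (hk : B.rank = k) :
    ∃ r c : Fin k → Fin n, (B.submatrix r c).det ≠ 0 := by
  subst hk
  have h1 : ∃ r : Fin B.rank → Fin n, LinearIndependent K (fun i => B.row (r i)) := by
    rw [B.rank_eq_finrank_span_row]
    obtain ⟨f, hf, -, hl⟩ := Submodule.exists_fun_fin_finrank_span_eq K (Set.range B.row)
    choose r hr using hf
    refine ⟨r, ?_⟩
    have : (fun i => B.row (r i)) = f := funext hr
    rw [this]; exact hl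
  obtain ⟨r, hr⟩ := h1
  set M := B.submatrix r id with hM
  have hMr : M.rank = B.rank := by
    have : LinearIndependent K M.row := hr
    rw [this.rank_matrix]; simp
  have h2 : ∃ c : Fin M.rank → Fin n, LinearIndependent K (fun i => M.col (c i)) := by
    rw [M.rank_eq_finrank_span_cols]
    obtain ⟨f, hf, -, hl⟩ := Submodule.exists_fun_fin_finrank_span_eq K (Set.range M.col)
    choose c hc using hf
    refine ⟨c, ?_⟩
    have : (fun i => M.col (c i)) = f := funext hc
    rw [this]; exact hl
  rw [hMr] at h2
  obtain ⟨c, hc⟩ := h2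
  refine ⟨r, c, ?_⟩
  have h3 : LinearIndependent K (B.submatrix r c).col := hc
  have h4 := Matrix.linearIndependent_cols_iff_isUnit.mp h3
  rw [Matrix.isUnit_iff_isUnit_det] at h4
  exact h4.ne_zero

lemma minor_degenerate_aux {n k : ℕ} (C C' : Fin n → Fin n → Fin n → ℝ) (w : Fin n → ℕ)
    (h0 : ∀ i j l, w i + w j < w l → C i j l = 0)
    (hC' : ∀ i j l, C' i j l = if w i + w j ≤ w l then C i j l else 0)
    (r c : Fin k → Fin n)
    (hdet : (Matrix.of fun i j => ∑ l : Fin n,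
      (MvPolynomial.C (C (r i) (c j) l) * MvPolynomial.X l : MvPolynomial (Fin n) ℝ)).det = 0) :
    (Matrix.of fun i j => ∑ l : Fin n,
      (MvPolynomial.C (C' (r i) (c j) l) * MvPolynomial.X l : MvPolynomial (Fin n) ℝ)).det = 0 := by
  let M : Matrix (Fin k) (Fin k) (Polynomial (MvPolynomial (Fin n) ℝ)) :=
    Matrix.of fun i j => ∑ l : Fin n,
      Polynomial.C (MvPolynomial.C (C (r i) (c j) l) * MvPolynomial.X l) *
        Polynomial.X ^ (w (r i) + w (c j) - w l)
  have hev : ∀ p : MvPolynomial (Fin n) ℝ, M.det.eval p = (Matrix.of fun i j => ∑ l : Fin n,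
      (MvPolynomial.C (C (r i) (c j) l) * MvPolynomial.X l) *
        p ^ (w (r i) + w (c j) - w l)).det := by
    intro p
    rw [← Polynomial.coe_evalRingHom, RingHom.map_det]
    congr 1
    ext1 i j
    simp [M, Polynomial.eval_finsetSum]
  have hz : M.det = 0 := by
    apply Polynomial.eq_zero_of_infinite_isRoot
    have hinf : (MvPolynomial.C '' {e : ℝ | e ≠ 0} : Set (MvPolynomial (Fin n) ℝ)).Infinite := by
      apply Set.Infinite.image (MvPolynomial.C_injective _ _).injOn
      exact (Set.finite_singleton (0:ℝ)).infinite_compl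
    refine hinf.mono ?_
    rintro _ ⟨e, he, rfl⟩
    have he : e ≠ 0 := he
    change M.det.eval _ = 0
    rw [hev]
    let σ : MvPolynomial (Fin n) ℝ →ₐ[ℝ] MvPolynomial (Fin n) ℝ :=
      MvPolynomial.aeval fun l => MvPolynomial.C (e⁻¹ ^ w l) * MvPolynomial.X l
    have hfac : (Matrix.of fun i j => ∑ l : Fin n,
        (MvPolynomial.C (C (r i) (c j) l) * MvPolynomial.X l : MvPolynomial (Fin n) ℝ) *
        (MvPolynomial.C e) ^ (w (r i) + w (c j) - w l)) =
        Matrix.diagonal (fun i => (MvPolynomial.C (e ^ w (r i)) : MvPolynomial (Fin n) ℝ)) *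
        (σ.toRingHom.mapMatrix (Matrix.of fun i j => ∑ l : Fin n,
          (MvPolynomial.C (C (r i) (c j) l) * MvPolynomial.X l : MvPolynomial (Fin n) ℝ))) *
        Matrix.diagonal (fun j => (MvPolynomial.C (e ^ w (c j)) : MvPolynomial (Fin n) ℝ)) := by
      ext1 i j
      rw [Matrix.mul_diagonal, Matrix.diagonal_mul]
      simp only [Matrix.of_apply, RingHom.mapMatrix_apply, Matrix.map_apply, map_sum,
        Finset.mul_sum, Finset.sum_mul]
      refine Finset.sum_congr rfl fun l _ => ?_
      have hσ : σ.toRingHom (MvPolynomial.C (C (r i) (c j) l) * MvPolynomial.X l) =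
          MvPolynomial.C (C (r i) (c j) l) * (MvPolynomial.C (e⁻¹ ^ w l) * MvPolynomial.X l) := by
        simp [σ, MvPolynomial.algebraMap_eq]
      rw [hσ]
      by_cases hw : w (r i) + w (c j) < w l
      · simp [h0 _ _ _ hw]
      · have h5 : e ^ (w (r i) + w (c j) - w l) = e ^ w (r i) * e⁻¹ ^ w l * e ^ w (c j) := by
          rw [pow_sub₀ _ he (not_lt.mp hw), pow_add, inv_pow]; ring
        rw [← MvPolynomial.C_pow, h5, MvPolynomial.C_mul, MvPolynomial.C_mul]
        ring
    rw [hfac, Matrix.det_mul, Matrix.det_mul, ← RingHom.map_det, hdet]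
    simp
  have h6 := hev 0
  rw [hz, Polynomial.eval_zero] at h6
  rw [h6]
  congr 1
  ext1 i j
  simp only [Matrix.of_apply]
  refine Finset.sum_congr rfl fun l _ => ?_
  rw [hC']
  by_cases hw : w (r i) + w (c j) ≤ w l
  · simp [hw]
  · have : w (r i) + w (c j) - w l ≠ 0 := by omega
    simp [hw, this]


/-- let `A` be the matrix `A i j = Σ_k C i j k · x_k` over
`ℝ[x_1,…,x_n]` and `B` the corresponding matrix for the contracted structure
constants `C′` (equal to `C` inside the subalgebra, and for the `m`-component of
brackets between the subalgebra and `m`, and zero otherwise).  Then, over the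
fraction field `ℝ(x_1,…,x_n)`, `rank B ≤ rank A`; consequently the number
`N(𝔤) = n − rank B` of functionally independent invariants of the contraction `𝔤`
is at least the number `N(𝔰) = n − rank A` for `𝔰`. -/
theorem contraction_rank_le_and_invariants_ge
    {n s : ℕ} (hs : s ≤ n) (C : Fin n → Fin n → Fin n → ℝ)
    -- antisymmetry of the structure constants
    (hanti : ∀ i j k : Fin n, C i j k = - C j i k)
    -- Jacobi identity for the structure constants
    (hjac : ∀ i j l r : Fin n,
      ∑ m : Fin n, (C i j m * C m l r + C j l m * C m i r + C l i m * C m j r) = 0)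
    -- `X_1,…,X_s` span a subalgebra `𝔰′`
    (hsub : ∀ i j k : Fin n, (i : ℕ) < s → (j : ℕ) < s → s ≤ (k : ℕ) → C i j k = 0)
    -- the complementary subspace `m` satisfies `[𝔰′, m] ⊆ m`
    (hmod : ∀ i j k : Fin n, (i : ℕ) < s → s ≤ (j : ℕ) → (k : ℕ) < s → C i j k = 0)
    -- the contracted structure constants
    (C' : Fin n → Fin n → Fin n → ℝ)
    (hC' : ∀ i j k : Fin n, C' i j k =
      if ((i : ℕ) < s ∧ (j : ℕ) < s ∧ (k : ℕ) < s) ∨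
         ((i : ℕ) < s ∧ s ≤ (j : ℕ) ∧ s ≤ (k : ℕ)) ∨
         ((j : ℕ) < s ∧ s ≤ (i : ℕ) ∧ s ≤ (k : ℕ)) then C i j k else 0)
    -- the commutator matrices over the fraction field `ℝ(x_1,…,x_n)`
    (A B : Matrix (Fin n) (Fin n) (FractionRing (MvPolynomial (Fin n) ℝ)))
    (hA : ∀ i j : Fin n, A i j =
      algebraMap (MvPolynomial (Fin n) ℝ) (FractionRing (MvPolynomial (Fin n) ℝ))
        (∑ k : Fin n, MvPolynomial.C (C i j k) * MvPolynomial.X k))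
    (hB : ∀ i j : Fin n, B i j =
      algebraMap (MvPolynomial (Fin n) ℝ) (FractionRing (MvPolynomial (Fin n) ℝ))
        (∑ k : Fin n, MvPolynomial.C (C' i j k) * MvPolynomial.X k)) :
    B.rank ≤ A.rank ∧ n - A.rank ≤ n - B.rank := by

  have key : B.rank ≤ A.rank := by
    obtain ⟨r, c, hrc⟩ := exists_minor_aux B rfl
    have hAdet : (A.submatrix r c).det ≠ 0 := by
      intro hA0
      apply hrc
      have e : ∀ (D : Fin n → Fin n → Fin n → ℝ)
          (N : Matrix (Fin n) (Fin n) (FractionRing (MvPolynomial (Fin n) ℝ))),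
          (∀ i j : Fin n, N i j =
            algebraMap (MvPolynomial (Fin n) ℝ) (FractionRing (MvPolynomial (Fin n) ℝ))
            (∑ k : Fin n, MvPolynomial.C (D i j k) * MvPolynomial.X k)) →
          (N.submatrix r c).det =
            algebraMap (MvPolynomial (Fin n) ℝ) (FractionRing (MvPolynomial (Fin n) ℝ))
            (Matrix.of fun i j => ∑ l : Fin n,
              (MvPolynomial.C (D (r i) (c j) l) * MvPolynomial.X l :
                MvPolynomial (Fin n) ℝ)).det := by
        intro D N hN
        rw [RingHom.map_det]
        congr 1
        ext1 i j
        simp only [Matrix.submatrix_apply, RingHom.mapMatrix_apply, Matrix.map_apply,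
          Matrix.of_apply]
        exact hN _ _
      rw [e C A hA] at hA0
      rw [e C' B hB]
      have hA1 := (map_eq_zero_iff _ (IsFractionRing.injective (MvPolynomial (Fin n) ℝ)
        (FractionRing (MvPolynomial (Fin n) ℝ)))).mp hA0
      rw [minor_degenerate_aux C C' (fun i => if (i : ℕ) < s then 0 else 1) ?_ ?_ r c hA1,
        map_zero]
      · intro i j l h
        apply hsub
        all_goals
          by_contra
          revert h
          split_ifs <;> omega
      · intro i j l
        rw [hC']
        by_cases hi : (i : ℕ) < s <;> by_cases hj : (j : ℕ) < s <;> by_cases hl : (l : ℕ) < s <;>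
          simp [hi, hj, hl, not_le.mpr, not_lt.mp]
        · exact (hsub i j l hi hj (not_lt.mp hl)).symm
    calc B.rank = (A.submatrix r c).rank := by
          rw [Matrix.rank_of_det_ne_zero hAdet, Fintype.card_fin]
      _ ≤ A.rank := Matrix.rank_submatrix_le _ _ _
  exact ⟨key, Nat.sub_le_sub_left key n⟩
end

section
/- If F, G ∈ ℝ[x_1,…,x_n] are bi-homogeneous subgroup scalars for the reduction 𝔰 ⊃ 𝔰′, then every bi-homogeneous component of their Lie–Poisson bracket {F,G} = Σ_{i,j,k} C_{ij}^k x_k (∂F/∂x_i)(∂G/∂x_j) is again a subgroup scalar for the reduction 𝔰 ⊃ 𝔰′. -/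
/-- The Lie–Poisson bracket `{F,G} = Σ_{i,j,k} C i j k · x_k · (∂F/∂x_i)(∂G/∂x_j)`. -/
noncomputable def liePoisson {n : ℕ} (C : Fin n → Fin n → Fin n → ℝ)
    (F G : MvPolynomial (Fin n) ℝ) : MvPolynomial (Fin n) ℝ :=
  ∑ i : Fin n, ∑ j : Fin n, ∑ k : Fin n,
    MvPolynomial.C (C i j k) * MvPolynomial.X k *
      (MvPolynomial.pderiv i F * MvPolynomial.pderiv j G)

/-- Degree of a monomial exponent `d` in the subalgebra variables `x_1,…,x_s`. -/
def deg1 {n : ℕ} (s : ℕ) (d : Fin n →₀ ℕ) : ℕ :=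
  ∑ j ∈ Finset.univ.filter (fun j : Fin n => (j : ℕ) < s), d j

/-- Degree of a monomial exponent `d` in the complementary variables `x_{s+1},…,x_n`. -/
def deg2 {n : ℕ} (s : ℕ) (d : Fin n →₀ ℕ) : ℕ :=
  ∑ j ∈ Finset.univ.filter (fun j : Fin n => s ≤ (j : ℕ)), d j

/-- A polynomial is bi-homogeneous of bi-degree `(a,b)` if every monomial in its support
has degree `a` in `x_1,…,x_s` and degree `b` in `x_{s+1},…,x_n`. -/
def IsBiHomogeneous {n : ℕ} (s : ℕ) (F : MvPolynomial (Fin n) ℝ) (a b : ℕ) : Prop :=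
  ∀ d ∈ F.support, deg1 s d = a ∧ deg2 s d = b

/-- The bi-homogeneous component of bi-degree `(a, b)` of a polynomial `F`. -/
noncomputable def biComponent {n : ℕ} (s : ℕ) (F : MvPolynomial (Fin n) ℝ) (a b : ℕ) :
    MvPolynomial (Fin n) ℝ :=
  ∑ d ∈ F.support.filter (fun d => deg1 s d = a ∧ deg2 s d = b),
    MvPolynomial.monomial d (F.coeff d)


open MvPolynomial in
/-- `hatOp` as a derivation. -/
noncomputable def hatDer {n : ℕ} (C : Fin n → Fin n → Fin n → ℝ) (i : Fin n) :
    Derivation ℝ (MvPolynomial (Fin n) ℝ) (MvPolynomial (Fin n) ℝ) :=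
  ∑ j : Fin n, ∑ k : Fin n, (MvPolynomial.C (C i j k) * MvPolynomial.X k) • pderiv j

theorem der_sum_apply {n : ℕ} {ι : Type*} (t : Finset ι)
    (f : ι → Derivation ℝ (MvPolynomial (Fin n) ℝ) (MvPolynomial (Fin n) ℝ))
    (F : MvPolynomial (Fin n) ℝ) : (∑ j ∈ t, f j) F = ∑ j ∈ t, f j F := by
  classical
  induction t using Finset.induction_on with
  | empty => simp
  | insert a t ha ih => simp [Finset.sum_insert ha, ih]

theorem hatDer_apply {n : ℕ} (C : Fin n → Fin n → Fin n → ℝ) (i : Fin n)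
    (F : MvPolynomial (Fin n) ℝ) : hatDer C i F = hatOp C i F := by
  simp [hatDer, hatOp, der_sum_apply]

theorem hatDer_X {n : ℕ} (C : Fin n → Fin n → Fin n → ℝ) (i l : Fin n) :
    hatDer C i (MvPolynomial.X l) = ∑ k, MvPolynomial.C (C i l k) * MvPolynomial.X k := by
  rw [hatDer_apply, hatOp, Finset.sum_eq_single l]
  · simp
  · intro j _ hj
    simp [MvPolynomial.pderiv_X_of_ne hj.symm]
  · simp

/-- `{F, ·}` as a derivation. -/
noncomputable def lpDer {n : ℕ} (C : Fin n → Fin n → Fin n → ℝ) (F : MvPolynomial (Fin n) ℝ) :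
    Derivation ℝ (MvPolynomial (Fin n) ℝ) (MvPolynomial (Fin n) ℝ) :=
  ∑ i : Fin n, MvPolynomial.pderiv i F • hatDer C i

theorem lpDer_apply {n : ℕ} (C : Fin n → Fin n → Fin n → ℝ) (F G : MvPolynomial (Fin n) ℝ) :
    lpDer C F G = liePoisson C F G := by
  simp only [lpDer, liePoisson, der_sum_apply, Derivation.smul_apply, hatDer_apply, hatOp,
    smul_eq_mul, Finset.mul_sum]
  refine Finset.sum_congr rfl fun i _ => Finset.sum_congr rfl fun j _ =>
    Finset.sum_congr rfl fun k _ => by ring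

theorem liePoisson_anti {n : ℕ} (C : Fin n → Fin n → Fin n → ℝ)
    (hanti : ∀ i j k : Fin n, C i j k = - C j i k) (F G : MvPolynomial (Fin n) ℝ) :
    liePoisson C F G = - liePoisson C G F := by
  unfold liePoisson
  rw [Finset.sum_comm]
  simp only [← Finset.sum_neg_distrib]
  refine Finset.sum_congr rfl fun i _ => Finset.sum_congr rfl fun j _ =>
    Finset.sum_congr rfl fun k _ => ?_
  rw [hanti j i k, map_neg]
  ring

theorem lpDer_anti {n : ℕ} (C : Fin n → Fin n → Fin n → ℝ)
    (hanti : ∀ i j k : Fin n, C i j k = - C j i k) (F G : MvPolynomial (Fin n) ℝ) :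
    lpDer C F G = - lpDer C G F := by
  rw [lpDer_apply, lpDer_apply, liePoisson_anti C hanti]

theorem lpDer_X {n : ℕ} (C : Fin n → Fin n → Fin n → ℝ) (l : Fin n)
    (G : MvPolynomial (Fin n) ℝ) :
    lpDer C (MvPolynomial.X l) G = hatDer C l G := by
  rw [lpDer, der_sum_apply, Finset.sum_eq_single l]
  · simp
  · intro j _ hj
    simp [MvPolynomial.pderiv_X_of_ne hj.symm]
  · simp

theorem hatDer_comm {n : ℕ} (C : Fin n → Fin n → Fin n → ℝ)
    (hanti : ∀ i j k : Fin n, C i j k = - C j i k)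
    (hjac : ∀ i j l r : Fin n,
      ∑ m : Fin n, (C i j m * C m l r + C j l m * C m i r + C l i m * C m j r) = 0)
    (i j : Fin n) :
    ⁅hatDer C i, hatDer C j⁆ =
      ∑ k, (MvPolynomial.C (C i j k) : MvPolynomial (Fin n) ℝ) • hatDer C k := by
  apply MvPolynomial.derivation_ext
  intro l
  rw [Derivation.commutator_apply, der_sum_apply]
  simp only [hatDer_X, map_sum, Derivation.leibniz, Derivation.smul_apply, smul_eq_mul,
    MvPolynomial.derivation_C, mul_zero, add_zero, Finset.mul_sum]
  rw [Finset.sum_comm, Finset.sum_comm (s := Finset.univ) (t := Finset.univ)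
    (f := fun x i_1 => MvPolynomial.C (C i l x) * (MvPolynomial.C (C j x i_1) * MvPolynomial.X i_1)),
    Finset.sum_comm (s := Finset.univ) (t := Finset.univ)
    (f := fun x i_1 => MvPolynomial.C (C i j x) * (MvPolynomial.C (C x l i_1) * MvPolynomial.X i_1)),
    ← Finset.sum_sub_distrib]
  refine Finset.sum_congr rfl fun r _ => ?_
  simp only [← mul_assoc, ← Finset.sum_mul, ← map_mul, ← map_sum, ← sub_mul, ← map_sub]
  congr 2
  rw [← sub_eq_zero, ← neg_eq_zero, ← hjac i j l r, ← Finset.sum_sub_distrib,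
    ← Finset.sum_sub_distrib, ← Finset.sum_neg_distrib]
  refine Finset.sum_congr rfl fun m _ => ?_
  rw [hanti l i m, hanti m i r, hanti m j r]
  ring

theorem hatDer_lpDer {n : ℕ} (C : Fin n → Fin n → Fin n → ℝ)
    (hanti : ∀ i j k : Fin n, C i j k = - C j i k)
    (hjac : ∀ i j l r : Fin n,
      ∑ m : Fin n, (C i j m * C m l r + C j l m * C m i r + C l i m * C m j r) = 0)
    (i : Fin n) (F : MvPolynomial (Fin n) ℝ) :
    ⁅hatDer C i, lpDer C F⁆ = lpDer C (hatDer C i F) := by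
  apply MvPolynomial.derivation_ext
  intro j
  have h := congrArg (fun D => D F) (hatDer_comm C hanti hjac i j)
  simp only [Derivation.commutator_apply, der_sum_apply, Derivation.smul_apply] at h
  rw [Derivation.commutator_apply, lpDer_anti C hanti F (MvPolynomial.X j),
    lpDer_anti C hanti (hatDer C i F) (MvPolynomial.X j), lpDer_X, lpDer_X, hatDer_X, map_sum]
  have h2 : ∀ k, lpDer C F (MvPolynomial.C (C i j k) * MvPolynomial.X k) =
      - ((MvPolynomial.C (C i j k) : MvPolynomial (Fin n) ℝ) • hatDer C k F) := by
    intro k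
    rw [Derivation.leibniz, lpDer_anti C hanti F (MvPolynomial.X k), lpDer_X]
    simp
  simp only [h2, Finset.sum_neg_distrib, ← h, map_neg]
  ring

theorem hatOp_liePoisson {n : ℕ} (C : Fin n → Fin n → Fin n → ℝ)
    (hanti : ∀ i j k : Fin n, C i j k = - C j i k)
    (hjac : ∀ i j l r : Fin n,
      ∑ m : Fin n, (C i j m * C m l r + C j l m * C m i r + C l i m * C m j r) = 0)
    (i : Fin n) (F G : MvPolynomial (Fin n) ℝ) (hF : hatOp C i F = 0) (hG : hatOp C i G = 0) :
    hatOp C i (liePoisson C F G) = 0 := by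
  have h := congrArg (fun D => D G) (hatDer_lpDer C hanti hjac i F)
  simp only [Derivation.commutator_apply, hatDer_apply, hF, hG, lpDer_apply, sub_zero] at h
  rw [← lpDer_apply C F 0, map_zero, sub_zero] at h
  rw [h]
  simp [liePoisson]

theorem deg_eq {n s : ℕ} (d e f : Fin n →₀ ℕ) (j k : Fin n)
    (hjk : (j : ℕ) < s ↔ (k : ℕ) < s)
    (hd : d = f + Finsupp.single j 1) (he : e = f + Finsupp.single k 1) :
    deg1 s d = deg1 s e ∧ deg2 s d = deg2 s e := by
  have hjk' : s ≤ (j : ℕ) ↔ s ≤ (k : ℕ) := by omega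
  subst hd he
  constructor
  · simp [deg1, Finset.sum_add_distrib, Finsupp.single_apply, hjk]
  · simp [deg2, Finset.sum_add_distrib, Finsupp.single_apply, hjk']

/-- The operators of the subalgebra preserve the bi-degree. -/
theorem exists_deg_of_mem_support {n s : ℕ} (C : Fin n → Fin n → Fin n → ℝ)
    (hC : ∀ i j k : Fin n, (i : ℕ) < s → C i j k ≠ 0 → ((j : ℕ) < s ↔ (k : ℕ) < s))
    (i : Fin n) (hi : (i : ℕ) < s) (H : MvPolynomial (Fin n) ℝ) (e : Fin n →₀ ℕ)
    (he : (hatOp C i H).coeff e ≠ 0) :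
    ∃ d, H.coeff d ≠ 0 ∧ deg1 s d = deg1 s e ∧ deg2 s d = deg2 s e := by
  classical
  rw [hatOp, MvPolynomial.coeff_sum] at he
  obtain ⟨j, -, hj⟩ := Finset.exists_ne_zero_of_sum_ne_zero he
  rw [MvPolynomial.coeff_sum] at hj
  obtain ⟨k, -, hk⟩ := Finset.exists_ne_zero_of_sum_ne_zero hj
  rw [mul_assoc, MvPolynomial.coeff_C_mul, MvPolynomial.coeff_X_mul'] at hk
  have h1 := left_ne_zero_of_mul hk
  have h2 := right_ne_zero_of_mul hk
  split_ifs at h2 with h3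
  · rw [MvPolynomial.coeff_pderiv] at h2
    refine ⟨_, left_ne_zero_of_mul h2, deg_eq _ _ _ j k (hC i j k hi h1) rfl ?_⟩
    rw [tsub_add_cancel_of_le]
    rw [Finsupp.single_le_iff]
    exact Nat.one_le_iff_ne_zero.2 (Finsupp.mem_support_iff.1 h3)
  · exact absurd rfl h2

theorem coeff_biComponent {n : ℕ} (s : ℕ) (F : MvPolynomial (Fin n) ℝ) (a b : ℕ)
    (e : Fin n →₀ ℕ) :
    (biComponent s F a b).coeff e = if deg1 s e = a ∧ deg2 s e = b then F.coeff e else 0 := by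
  classical
  rw [biComponent, MvPolynomial.coeff_sum]
  simp only [MvPolynomial.coeff_monomial, Finset.sum_ite_eq', Finset.mem_filter,
    MvPolynomial.mem_support_iff]
  split_ifs <;> simp_all

/-- if `F` and `G` are bi-homogeneous subgroup scalars for the reduction
`𝔰 ⊃ 𝔰′`, then every bi-homogeneous component of their Lie–Poisson bracket `{F,G}`
is again a subgroup scalar for the reduction `𝔰 ⊃ 𝔰′`. -/
theorem biComponents_of_liePoisson_are_subgroup_scalars
    {n s : ℕ} (hs : s ≤ n) (C : Fin n → Fin n → Fin n → ℝ)
    -- antisymmetry of the structure constants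
    (hanti : ∀ i j k : Fin n, C i j k = - C j i k)
    -- Jacobi identity for the structure constants
    (hjac : ∀ i j l r : Fin n,
      ∑ m : Fin n, (C i j m * C m l r + C j l m * C m i r + C l i m * C m j r) = 0)
    -- `X_1,…,X_s` span a subalgebra `𝔰′`
    (hsub : ∀ i j k : Fin n, (i : ℕ) < s → (j : ℕ) < s → s ≤ (k : ℕ) → C i j k = 0)
    -- the complementary subspace `m` satisfies `[𝔰′, m] ⊆ m`
    (hmod : ∀ i j k : Fin n, (i : ℕ) < s → s ≤ (j : ℕ) → (k : ℕ) < s → C i j k = 0)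
    (F G : MvPolynomial (Fin n) ℝ) (a b a' b' : ℕ)
    (hFbh : IsBiHomogeneous s F a b) (hGbh : IsBiHomogeneous s G a' b')
    (hF : ∀ i : Fin n, (i : ℕ) < s → hatOp C i F = 0)
    (hG : ∀ i : Fin n, (i : ℕ) < s → hatOp C i G = 0) :
    ∀ (c d : ℕ) (i : Fin n), (i : ℕ) < s →
      hatOp C i (biComponent s (liePoisson C F G) c d) = 0 := by
  intro c d i hi
  have h0 := hatOp_liePoisson C hanti hjac i F G (hF i hi) (hG i hi)
  generalize liePoisson C F G = H at h0
  have hC : ∀ i j k : Fin n, (i : ℕ) < s → C i j k ≠ 0 → ((j : ℕ) < s ↔ (k : ℕ) < s) := by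
    intro i j k hi hne
    constructor
    · intro hj
      by_contra hk
      exact hne (hsub i j k hi hj (by omega))
    · intro hk
      by_contra hj
      exact hne (hmod i j k hi (by omega) hk)
  ext e
  rw [MvPolynomial.coeff_zero]
  by_contra hne
  obtain ⟨u, hu, hu1, hu2⟩ := exists_deg_of_mem_support C hC i hi _ e hne
  have hsplit : hatOp C i (H - biComponent s H c d) = - hatOp C i (biComponent s H c d) := by
    rw [← hatDer_apply, map_sub, hatDer_apply, hatDer_apply, h0, zero_sub]
  have hne' : (hatOp C i (H - biComponent s H c d)).coeff e ≠ 0 := by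
    rw [hsplit, MvPolynomial.coeff_neg]
    exact neg_ne_zero.2 hne
  obtain ⟨v, hv, hv1, hv2⟩ := exists_deg_of_mem_support C hC i hi _ e hne'
  rw [coeff_biComponent] at hu
  rw [MvPolynomial.coeff_sub, coeff_biComponent, hv1, hv2, ← hu1, ← hu2] at hv
  split_ifs at hu hv with h
  · exact hv (sub_self _)
  · exact hu rfl
end

section
/- Let J = diag(1,1,−1,−1) ∈ M₄(ℂ) and let 𝔰𝔲(2,2) = {X ∈ M₄(ℂ) : XᴴJ + JX = 0 and tr X = 0}, a real Lie subalgebra of M₄(ℂ). Then: (a) for every X ∈ 𝔰𝔲(2,2) the coefficient of λ³ in the characteristic polynomial det(λ·I₄ − X) vanishes, so det(λ·I₄ − X) = λ⁴ + D₂(X)λ² + D₃(X)λ + D₄(X); (b) each coefficient function D_k (k = 2,3,4) satisfies D_k(gXg⁻¹) = D_k(X) for every g ∈ GL₄(ℂ) with gᴴJg = J and every X ∈ 𝔰𝔲(2,2); (c) the three functions D₂, D₃, D₄ : 𝔰𝔲(2,2) → ℂ are algebraically independent over ℝ in the commutative ring of all functions from 𝔰𝔲(2,2) to ℂ. -/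
open Matrix

/-- The Hermitian form of signature `(2,2)`: `J = diag(1,1,−1,−1)`. -/
noncomputable def Jsu : Matrix (Fin 4) (Fin 4) ℂ := Matrix.diagonal ![1, 1, -1, -1]

/-- The real Lie algebra `𝔰𝔲(2,2)` of trace-free complex `4×4` matrices skew-adjoint
with respect to `J = diag(1,1,−1,−1)`. -/
def su22 : Set (Matrix (Fin 4) (Fin 4) ℂ) :=
  {M | Mᴴ * Jsu + Jsu * M = 0 ∧ M.trace = 0}

/-- `D₂ = ` coefficient of `λ²` in the characteristic polynomial `det(λ·I₄ − M)`. -/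
noncomputable def Dsu2 (M : Matrix (Fin 4) (Fin 4) ℂ) : ℂ := M.charpoly.coeff 2

/-- `D₃ = ` coefficient of `λ` in the characteristic polynomial. -/
noncomputable def Dsu3 (M : Matrix (Fin 4) (Fin 4) ℂ) : ℂ := M.charpoly.coeff 1

/-- `D₄ = ` constant coefficient of the characteristic polynomial. -/
noncomputable def Dsu4 (M : Matrix (Fin 4) (Fin 4) ℂ) : ℂ := M.charpoly.coeff 0

/-- A matrix of `su22` realizing prescribed coefficients. -/
noncomputable def famM (p q r : ℂ) : Matrix (Fin 4) (Fin 4) ℂ :=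
  (Complex.I / 2) • !![r, p+q+1, p-q-1, -r;
     1+q+p, 1, 1, 1-q-p;
     1+q-p, -1, -1, 1-q+p;
     r, p+q-1, p-q+1, -r]

lemma famM_mem (p q r : ℝ) : famM p q r ∈ su22 := by
  constructor
  · have hc : (starRingEnd ℂ) 2 = 2 := Complex.conj_ofNat 2
    ext i j
    fin_cases i <;> fin_cases j <;>
      simp [famM, Jsu, Matrix.mul_apply, Matrix.diagonal, hc] <;> ring
  · simp [famM, Matrix.trace, Fin.sum_univ_four]

lemma famM_charpoly (p q r : ℂ) : (famM p q r).charpoly =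
    Polynomial.X ^ 4 + Polynomial.C (2 * p) * Polynomial.X ^ 2 +
      Polynomial.C (2 * Complex.I * q) * Polynomial.X + Polynomial.C (p ^ 2 - r) := by
  apply Polynomial.funext
  intro t
  rw [Matrix.eval_charpoly]
  have h2 : Complex.I ^ 2 = -1 := Complex.I_sq
  have h3 : Complex.I ^ 3 = -Complex.I := Complex.I_pow_three
  have h4 : Complex.I ^ 4 = 1 := Complex.I_pow_four
  simp [famM, Matrix.det_succ_row_zero, Fin.sum_univ_succ, Fin.succAbove, Matrix.scalar_apply]
  ring_nf
  simp only [h2, h3, h4]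
  ring

lemma charpoly_form (M : Matrix (Fin 4) (Fin 4) ℂ) (h : M.trace = 0) :
    M.charpoly.coeff 3 = 0 ∧
      M.charpoly = Polynomial.X ^ 4 + Polynomial.C (Dsu2 M) * Polynomial.X ^ 2 +
        Polynomial.C (Dsu3 M) * Polynomial.X + Polynomial.C (Dsu4 M) := by
  have h3 : M.charpoly.coeff 3 = 0 := by
    have := Matrix.trace_eq_neg_charpoly_coeff M
    simp [h] at this
    exact this
  refine ⟨h3, ?_⟩
  have hd : M.charpoly.natDegree = 4 := by simp
  have hm : M.charpoly.coeff 4 = 1 := by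
    have := M.charpoly_monic.coeff_natDegree
    rwa [hd] at this
  conv_lhs => rw [M.charpoly.as_sum_range_C_mul_X_pow, hd]
  simp [Finset.sum_range_succ, h3, hm, Dsu2, Dsu3, Dsu4]
  ring

lemma charpoly_conj (g M : Matrix (Fin 4) (Fin 4) ℂ) (hg : IsUnit g) :
    (g * M * g⁻¹).charpoly = M.charpoly := by
  obtain ⟨u, rfl⟩ := hg
  have := Matrix.charpoly_units_conj u M
  simpa using this

lemma famM_D (p q r : ℂ) : Dsu2 (famM p q r) = 2 * p ∧
    Dsu3 (famM p q r) = 2 * Complex.I * q ∧ Dsu4 (famM p q r) = p ^ 2 - r := by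
  refine ⟨?_, ?_, ?_⟩ <;> simp only [Dsu2, Dsu3, Dsu4, famM_charpoly] <;>
    simp [Polynomial.coeff_X, Polynomial.coeff_C, Polynomial.coeff_X_pow, -map_mul, -map_sub]

lemma part_c : AlgebraicIndependent ℝ
      (![fun M : su22 => Dsu2 M.val,
         fun M : su22 => Dsu3 M.val,
         fun M : su22 => Dsu4 M.val] : Fin 3 → (su22 → ℂ)) := by
  rw [algebraicIndependent_iff]
  intro P hP
  have key : ∀ x y z : ℝ,
      MvPolynomial.aeval (![(x : ℂ), Complex.I * y, z] : Fin 3 → ℂ) P = 0 := by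
    intro x y z
    let M : su22 := ⟨famM ((x/2 : ℝ) : ℂ) ((y/2 : ℝ) : ℂ) (((x/2)^2 - z : ℝ) : ℂ), famM_mem _ _ _⟩
    have h1 := congrFun hP M
    have h2 := (MvPolynomial.comp_aeval_apply
      (![fun M : su22 => Dsu2 M.val, fun M : su22 => Dsu3 M.val,
         fun M : su22 => Dsu4 M.val] : Fin 3 → (su22 → ℂ)) (Pi.evalAlgHom ℝ (fun _ : su22 => ℂ) M) P)
    have h3 : (fun i => (Pi.evalAlgHom ℝ (fun _ : su22 => ℂ) M)
        ((![fun M : su22 => Dsu2 M.val, fun M : su22 => Dsu3 M.val,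
         fun M : su22 => Dsu4 M.val] : Fin 3 → (su22 → ℂ)) i)) = ![(x : ℂ), Complex.I * y, z] := by
      obtain ⟨a, b, c⟩ := famM_D ((x/2 : ℝ) : ℂ) ((y/2 : ℝ) : ℂ) (((x/2)^2 - z : ℝ) : ℂ)
      funext i
      fin_cases i
      · change Dsu2 (famM _ _ _) = _
        rw [a]; simp; ring
      · change Dsu3 (famM _ _ _) = _
        rw [b]; simp; ring
      · change Dsu4 (famM _ _ _) = _
        rw [c]; simp
    rw [h3] at h2
    rw [← h2]
    exact h1
  have hinj := MvPolynomial.map_injective (σ := Fin 3) (algebraMap ℝ ℂ) (algebraMap ℝ ℂ).injective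
  apply hinj
  rw [map_zero]
  have hi1 : (Set.range (fun x : ℝ => (x : ℂ))).Infinite :=
    Set.infinite_range_of_injective Complex.ofReal_injective
  have hi2 : (Set.range (fun x : ℝ => Complex.I * (x : ℂ))).Infinite :=
    Set.infinite_range_of_injective
      ((mul_right_injective₀ Complex.I_ne_zero).comp Complex.ofReal_injective)
  apply MvPolynomial.funext_set ![Set.range (fun x : ℝ => (x : ℂ)),
    Set.range (fun x : ℝ => Complex.I * (x : ℂ)), Set.range (fun x : ℝ => (x : ℂ))]
  · intro i
    fin_cases i
    exacts [hi1, hi2, hi1]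
  · intro v hv
    obtain ⟨x, hx⟩ := hv 0 (Set.mem_univ _)
    obtain ⟨y, hy⟩ := hv 1 (Set.mem_univ _)
    obtain ⟨z, hz⟩ := hv 2 (Set.mem_univ _)
    have hv' : v = ![(x : ℂ), Complex.I * y, z] := by
      funext i
      fin_cases i
      exacts [hx.symm, hy.symm, hz.symm]
    rw [hv', MvPolynomial.eval_map, map_zero]
    exact key x y z

/-- (a) for every `M ∈ 𝔰𝔲(2,2)` the coefficient of `λ³` in the
characteristic polynomial vanishes, so `det(λI₄ − M) = λ⁴ + D₂(M)λ² + D₃(M)λ + D₄(M)`;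
(b) each `D_k` is invariant under conjugation by any `g ∈ GL₄(ℂ)` with `gᴴJg = J`;
(c) the functions `D₂, D₃, D₄ : 𝔰𝔲(2,2) → ℂ` are algebraically independent over `ℝ`
in the commutative ring of all functions `𝔰𝔲(2,2) → ℂ`. -/
theorem su22_casimir_coefficients :
    -- (a)
    (∀ M ∈ su22, M.charpoly.coeff 3 = 0 ∧
      M.charpoly = Polynomial.X ^ 4 + Polynomial.C (Dsu2 M) * Polynomial.X ^ 2 +
        Polynomial.C (Dsu3 M) * Polynomial.X + Polynomial.C (Dsu4 M)) ∧
    -- (b)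
    (∀ g : Matrix (Fin 4) (Fin 4) ℂ, IsUnit g → gᴴ * Jsu * g = Jsu →
      ∀ M ∈ su22,
        Dsu2 (g * M * g⁻¹) = Dsu2 M ∧ Dsu3 (g * M * g⁻¹) = Dsu3 M ∧
          Dsu4 (g * M * g⁻¹) = Dsu4 M) ∧
    -- (c)
    AlgebraicIndependent ℝ
      (![fun M : su22 => Dsu2 M.val,
         fun M : su22 => Dsu3 M.val,
         fun M : su22 => Dsu4 M.val] : Fin 3 → (su22 → ℂ)) := by
  refine ⟨fun M hM => charpoly_form M hM.2, ?_, part_c⟩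
  intro g hg _ M _
  simp only [Dsu2, Dsu3, Dsu4, charpoly_conj g M hg, and_self]
end

section
/- Let J ∈ M₆(ℝ) be the standard symplectic matrix (J² = −I₆, Jᵀ = −J), let 𝔰𝔭(6,ℝ) = {X ∈ M₆(ℝ) : XᵀJ + JX = 0}, and let c₂, c₄, c₆ : 𝔰𝔭(6,ℝ) → ℝ be the coefficient functions determined by det(T·I₆ − X) = T⁶ + c₂(X)T⁴ + c₄(X)T² + c₆(X). Then each c_k satisfies c_k(gXg⁻¹) = c_k(X) for every g ∈ GL₆(ℝ) with gᵀJg = J and every X ∈ 𝔰𝔭(6,ℝ), and the three functions c₂, c₄, c₆ are algebraically independent over ℝ in the commutative ring of all functions from 𝔰𝔭(6,ℝ) to ℝ. -/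
open Matrix

/-- A matrix in the standard symplectic algebra with prescribed characteristic polynomial. -/
def sp6Y (a b c : ℝ) : Matrix (Fin 6) (Fin 6) ℝ :=
  !![0, 0, 0, 0, 0, 1;
     0, 0, 0, 0, 1, -a;
     0, 0, 0, 1, -a, a ^ 2 - b;
     -c, 0, 0, 0, 0, 0;
     0, a, 1, 0, 0, 0;
     0, 1, 0, 0, 0, 0]

/-- The standard symplectic matrix. -/
def sp6J0 : Matrix (Fin 6) (Fin 6) ℝ :=
  !![0, 0, 0, -1, 0, 0;
     0, 0, 0, 0, -1, 0;
     0, 0, 0, 0, 0, -1;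
     1, 0, 0, 0, 0, 0;
     0, 1, 0, 0, 0, 0;
     0, 0, 1, 0, 0, 0]

open Polynomial in
lemma sp6Y_charpoly (a b c : ℝ) :
    (sp6Y a b c).charpoly = X ^ 6 + C a * X ^ 4 + C b * X ^ 2 + C c := by
  have h : (sp6Y a b c).charmatrix =
    !![X, 0, 0, 0, 0, -1;
     0, X, 0, 0, -1, C a;
     0, 0, X, -1, C a, -(C a ^ 2 - C b);
     C c, 0, 0, X, 0, 0;
     0, -C a, -1, 0, X, 0;
     0, -1, 0, 0, 0, X] := by
    ext1 i j
    fin_cases i <;> fin_cases j <;> simp [sp6Y]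
  rw [Matrix.charpoly, h]
  simp [Matrix.det_succ_row_zero, Fin.sum_univ_succ, Fin.succAbove]
  ring

lemma sp6Y_mem (a b c : ℝ) : (sp6Y a b c)ᵀ * sp6J0 + sp6J0 * sp6Y a b c = 0 := by
  ext i j
  fin_cases i <;> fin_cases j <;>
    simp [sp6Y, sp6J0, Matrix.mul_apply, Fin.sum_univ_succ]

lemma sp6J0_sq : sp6J0 * sp6J0 = -1 := by
  ext i j
  fin_cases i <;> fin_cases j <;>
    simp [sp6J0, Matrix.mul_apply, Fin.sum_univ_succ]

lemma sp6_exists_unit (v : Fin 4 → Fin 6 → ℝ) :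
    ∃ u : Fin 6 → ℝ, u ⬝ᵥ u = 1 ∧ ∀ i, v i ⬝ᵥ u = 0 := by
  have h := LinearMap.ker_ne_bot_of_finrank_lt (f := (Matrix.of v).mulVecLin) (by simp)
  obtain ⟨x, hx, hx0⟩ := Submodule.exists_mem_ne_zero_of_ne_bot h
  have hpos : 0 < x ⬝ᵥ x := by
    have h1 : x ⬝ᵥ x ≠ 0 := by simpa using hx0
    have h2 : 0 ≤ x ⬝ᵥ x := Finset.sum_nonneg fun i _ => mul_self_nonneg _
    exact lt_of_le_of_ne h2 h1.symm
  refine ⟨(Real.sqrt (x ⬝ᵥ x))⁻¹ • x, ?_, fun i => ?_⟩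
  · have hs := Real.mul_self_sqrt hpos.le
    have hs0 : Real.sqrt (x ⬝ᵥ x) ≠ 0 := (Real.sqrt_pos.2 hpos).ne'
    rw [smul_dotProduct, dotProduct_smul, smul_eq_mul, smul_eq_mul]
    field_simp
    rw [sq, hs]
  · have : v i ⬝ᵥ x = 0 := congrFun (LinearMap.mem_ker.1 hx) i
    rw [dotProduct_smul, this, smul_zero]

lemma sp6_darboux (J : Matrix (Fin 6) (Fin 6) ℝ) (hJ2 : J * J = -1) (hJt : Jᵀ = -J) :
    ∃ S : Matrix (Fin 6) (Fin 6) ℝ, Sᵀ * J * S = sp6J0 := by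
  have skew : ∀ x y : Fin 6 → ℝ, (J *ᵥ x) ⬝ᵥ y = - (x ⬝ᵥ J *ᵥ y) := by
    intro x y
    rw [dotProduct_mulVec, ← mulVec_transpose, hJt, neg_mulVec, neg_dotProduct, neg_neg]
  have sq : ∀ x : Fin 6 → ℝ, J *ᵥ (J *ᵥ x) = -x := by
    intro x
    rw [mulVec_mulVec, hJ2, neg_mulVec, one_mulVec]
  have self : ∀ x : Fin 6 → ℝ, x ⬝ᵥ J *ᵥ x = 0 := by
    intro x
    have := skew x x
    rw [dotProduct_comm] at this
    linarith
  obtain ⟨u, hu, -⟩ := sp6_exists_unit 0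
  obtain ⟨v, hv, hv'⟩ := sp6_exists_unit ![u, J *ᵥ u, 0, 0]
  obtain ⟨w, hw, hw'⟩ := sp6_exists_unit ![u, J *ᵥ u, v, J *ᵥ v]
  have uv : u ⬝ᵥ v = 0 := hv' 0
  have uJv : u ⬝ᵥ J *ᵥ v = 0 := by
    have : (J *ᵥ u) ⬝ᵥ v = 0 := hv' 1
    rw [skew] at this; linarith
  have uw : u ⬝ᵥ w = 0 := hw' 0
  have uJw : u ⬝ᵥ J *ᵥ w = 0 := by
    have : (J *ᵥ u) ⬝ᵥ w = 0 := hw' 1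
    rw [skew] at this; linarith
  have vw : v ⬝ᵥ w = 0 := hw' 2
  have vJw : v ⬝ᵥ J *ᵥ w = 0 := by
    have : (J *ᵥ v) ⬝ᵥ w = 0 := hw' 3
    rw [skew] at this; linarith
  have vJu : v ⬝ᵥ J *ᵥ u = 0 := by rw [dotProduct_comm, skew, uJv, neg_zero]
  have wJu : w ⬝ᵥ J *ᵥ u = 0 := by rw [dotProduct_comm, skew, uJw, neg_zero]
  have wJv : w ⬝ᵥ J *ᵥ v = 0 := by rw [dotProduct_comm, skew, vJw, neg_zero]
  have vu : v ⬝ᵥ u = 0 := by rw [dotProduct_comm, uv]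
  have wu : w ⬝ᵥ u = 0 := by rw [dotProduct_comm, uw]
  have wv : w ⬝ᵥ v = 0 := by rw [dotProduct_comm, vw]
  let f : Fin 6 → Fin 6 → ℝ := ![u, v, w, J *ᵥ u, J *ᵥ v, J *ᵥ w]
  refine ⟨(Matrix.of f)ᵀ, ?_⟩
  ext i j
  have key : ((Matrix.of f)ᵀᵀ * J * (Matrix.of f)ᵀ) i j = f i ⬝ᵥ J *ᵥ f j := by
    rw [Matrix.mul_assoc]; rfl
  rw [key]
  fin_cases i <;> fin_cases j <;>
    simp [f, sp6J0, skew, sq, self, hu, hv, hw, uv, uJv, uw, uJw, vw, vJw, vJu, wJu, wJv,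
      vu, wu, wv, mulVec_neg]

lemma sp6_conj (S R Y : Matrix (Fin 6) (Fin 6) ℝ) (h' : R * S = 1) :
    (S * Y * R).charpoly = Y.charpoly := by
  rw [Matrix.charpoly_mul_comm, ← Matrix.mul_assoc, h', Matrix.one_mul]

lemma sp6_exists (J : Matrix (Fin 6) (Fin 6) ℝ) (hJ2 : J * J = -1) (hJt : Jᵀ = -J)
    (a b c : ℝ) : ∃ X : Matrix (Fin 6) (Fin 6) ℝ, Xᵀ * J + J * X = 0 ∧
      X.charpoly = (sp6Y a b c).charpoly := by
  obtain ⟨S, hS⟩ := sp6_darboux J hJ2 hJt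
  obtain ⟨R, hRS⟩ : ∃ R, R * S = 1 := ⟨-(sp6J0 * (Sᵀ * J)), by
    rw [Matrix.neg_mul, Matrix.mul_assoc, hS, sp6J0_sq, neg_neg]⟩
  have hSR : S * R = 1 := mul_eq_one_comm.1 hRS
  have hT : Rᵀ * Sᵀ = 1 := by rw [← transpose_mul, hSR, transpose_one]
  have hJ : J = Rᵀ * sp6J0 * R := by
    rw [← hS]
    calc J = (Rᵀ * Sᵀ) * J * (S * R) := by rw [hT, hSR]; simp
      _ = _ := by simp only [Matrix.mul_assoc]
  refine ⟨S * sp6Y a b c * R, ?_, ?_⟩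
  · have hT' : Sᵀ * Rᵀ = 1 := by rw [← transpose_mul, hRS, transpose_one]
    have e1 : (S * sp6Y a b c * R)ᵀ * J = Rᵀ * ((sp6Y a b c)ᵀ * sp6J0) * R := by
      rw [hJ, transpose_mul, transpose_mul]
      calc _ = Rᵀ * ((sp6Y a b c)ᵀ * (Sᵀ * Rᵀ) * sp6J0) * R := by
            simp only [Matrix.mul_assoc]
        _ = _ := by rw [hT', Matrix.mul_one]
    have e2 : J * (S * sp6Y a b c * R) = Rᵀ * (sp6J0 * sp6Y a b c) * R := by
      rw [hJ]
      calc _ = Rᵀ * (sp6J0 * (R * S) * sp6Y a b c) * R := by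
            simp only [Matrix.mul_assoc]
        _ = _ := by rw [hRS, Matrix.mul_one]
    rw [e1, e2, ← Matrix.add_mul, ← Matrix.mul_add, sp6Y_mem]
    simp
  · exact sp6_conj S R _ hRS

/-- let `J ∈ M₆(ℝ)` be the standard symplectic matrix (`J² = −I₆`,
`Jᵀ = −J`) and let `c₂, c₄, c₆ : 𝔰𝔭(6,ℝ) → ℝ` be the coefficient functions determined
by `det(T·I₆ − X) = T⁶ + c₂(X)T⁴ + c₄(X)T² + c₆(X)` (so `c₂ X = coeff 4`,
`c₄ X = coeff 2`, `c₆ X = coeff 0` of the characteristic polynomial).  Then each `c_k`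
is invariant under conjugation by any `g ∈ GL₆(ℝ)` with `gᵀJg = J`, and the three
functions `c₂, c₄, c₆` are algebraically independent over `ℝ` in the commutative ring
of all functions `𝔰𝔭(6,ℝ) → ℝ`. -/
theorem sp6_casimir_invariance_and_independence
    (J : Matrix (Fin 6) (Fin 6) ℝ) (hJ2 : J * J = -1) (hJt : Jᵀ = -J) :
    -- invariance of the coefficient functions under the symplectic group
    (∀ g : Matrix (Fin 6) (Fin 6) ℝ, IsUnit g → gᵀ * J * g = J →
      ∀ X : Matrix (Fin 6) (Fin 6) ℝ, Xᵀ * J + J * X = 0 →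
        (g * X * g⁻¹).charpoly.coeff 4 = X.charpoly.coeff 4 ∧
        (g * X * g⁻¹).charpoly.coeff 2 = X.charpoly.coeff 2 ∧
        (g * X * g⁻¹).charpoly.coeff 0 = X.charpoly.coeff 0) ∧
    -- algebraic independence of `c₂, c₄, c₆` as functions on `𝔰𝔭(6,ℝ)`
    AlgebraicIndependent ℝ
      (![fun X : {X : Matrix (Fin 6) (Fin 6) ℝ // Xᵀ * J + J * X = 0} =>
           X.val.charpoly.coeff 4,
         fun X : {X : Matrix (Fin 6) (Fin 6) ℝ // Xᵀ * J + J * X = 0} =>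
           X.val.charpoly.coeff 2,
         fun X : {X : Matrix (Fin 6) (Fin 6) ℝ // Xᵀ * J + J * X = 0} =>
           X.val.charpoly.coeff 0] :
        Fin 3 → ({X : Matrix (Fin 6) (Fin 6) ℝ // Xᵀ * J + J * X = 0} → ℝ)) := by
  constructor
  · intro g hg _ X _
    have h : (g * X * g⁻¹).charpoly = X.charpoly := by
      have hd := (Matrix.isUnit_iff_isUnit_det g).1 hg
      exact Matrix.charpoly_units_conj
        ⟨g, g⁻¹, Matrix.mul_nonsing_inv g hd, Matrix.nonsing_inv_mul g hd⟩ X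
    rw [h]
    exact ⟨rfl, rfl, rfl⟩
  · rw [algebraicIndependent_iff]
    intro p hp
    apply MvPolynomial.funext
    intro v
    obtain ⟨X, hX, hc⟩ := sp6_exists J hJ2 hJt (v 0) (v 1) (v 2)
    have h := congrArg (Pi.evalAlgHom ℝ (fun _ => ℝ) ⟨X, hX⟩) hp
    rw [MvPolynomial.comp_aeval_apply, map_zero] at h
    rw [sp6Y_charpoly] at hc
    have hv : (fun i => Pi.evalAlgHom ℝ (fun _ => ℝ) ⟨X, hX⟩
        ((![fun X : {X : Matrix (Fin 6) (Fin 6) ℝ // Xᵀ * J + J * X = 0} =>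
           X.val.charpoly.coeff 4,
         fun X : {X : Matrix (Fin 6) (Fin 6) ℝ // Xᵀ * J + J * X = 0} =>
           X.val.charpoly.coeff 2,
         fun X : {X : Matrix (Fin 6) (Fin 6) ℝ // Xᵀ * J + J * X = 0} =>
           X.val.charpoly.coeff 0] :
        Fin 3 → ({X : Matrix (Fin 6) (Fin 6) ℝ // Xᵀ * J + J * X = 0} → ℝ)) i)) = v := by
      funext i
      fin_cases i <;>
        simp [hc, Polynomial.coeff_X_pow, Polynomial.coeff_C]
    rw [hv] at h
    rw [map_zero, ← h, MvPolynomial.aeval_eq_eval]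
end
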